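/- Let q be a prime power. For all δ and r' such that 0 ≤ δ < q − 1 and 0 ≤ r' < q² − 2δ − 2, there exists a pure F_q-linear [[q², q² − 2δ − 2 − r', r', δ+2]]_q MDS subsystem code. -/

import Mathlib

open scoped BigOperators

/-- The symplectic weight of a vector `(x|y) ∈ F_q^n × F_q^n`: the number of
coordinates `i` with `(x_i, y_i) ≠ (0,0)`. -/
noncomputable def swt {F : Type*} [Field F] {n : ℕ} (v : (Fin n → F) × (Fin n → F)) : ℕ :=
  Nat.card {i : Fin n // ¬(v.1 i = 0 ∧ v.2 i = 0)}

/-- The minimum symplectic weight of the nonzero elements of a set `X`. -/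
noncomputable def minSwt {F : Type*} [Field F] {n : ℕ}
    (X : Set ((Fin n → F) × (Fin n → F))) : ℕ :=
  sInf (swt '' {v ∈ X | v ≠ 0})

/-- The trace-symplectic form `⟨(a|b)|(a'|b')⟩ₛ = Tr_{F_q/F_p}(a'·b − a·b')`. -/
noncomputable def traceSymp (p : ℕ) {F : Type*} [Field F] [Algebra (ZMod p) F] {n : ℕ}
    (u w : (Fin n → F) × (Fin n → F)) : ZMod p :=
  Algebra.trace (ZMod p) F (∑ i, (w.1 i * u.2 i - u.1 i * w.2 i))

/-- The trace-symplectic dual of a set `C ⊆ F_q^{2n}`. -/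
def sdual (p : ℕ) {F : Type*} [Field F] [Algebra (ZMod p) F] {n : ℕ}
    (C : Set ((Fin n → F) × (Fin n → F))) : Set ((Fin n → F) × (Fin n → F)) :=
  {v | ∀ w ∈ C, traceSymp p v w = 0}

/-- `C` is (the additive code associated with) an `((n,K,R,d))_q` Clifford subsystem code:
with `D = C ∩ C^⊥s`, `|C| = q^n R / K`, `|D| = q^n/(KR)`, and `d = swt(D^⊥s − C)` if
`C ≠ D^⊥s`, else `d = swt(D^⊥s)`. -/
def IsSubsysCode (p : ℕ) {F : Type*} [Field F] [Fintype F] [Algebra (ZMod p) F] {n : ℕ}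
    (K R d : ℕ) (C : AddSubgroup ((Fin n → F) × (Fin n → F))) : Prop :=
  let S : Set ((Fin n → F) × (Fin n → F)) := ↑C
  let D : Set ((Fin n → F) × (Fin n → F)) := S ∩ sdual p S
  let Dp : Set ((Fin n → F) × (Fin n → F)) := sdual p D
  K * Nat.card C = Fintype.card F ^ n * R ∧
  K * R * Nat.card D = Fintype.card F ^ n ∧
  (S = Dp → d = minSwt Dp) ∧
  (S ≠ Dp → d = minSwt (Dp \ S))

/-- `C` is (the linear code associated with) an `F_q`-linear `[[n,k,r,d]]_q` subsystem code. -/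
def IsLinSubsysCode (p : ℕ) {F : Type*} [Field F] [Fintype F] [Algebra (ZMod p) F] {n : ℕ}
    (k r d : ℕ) (C : Submodule F ((Fin n → F) × (Fin n → F))) : Prop :=
  IsSubsysCode p (Fintype.card F ^ k) (Fintype.card F ^ r) d C.toAddSubgroup

open Module Polynomial

namespace LinearMap.BilinForm

/-- An alternating form restricted to the span of a non-orthogonal pair is nondegenerate. -/
theorem disjoint_span_pair_orthogonal {F V : Type*} [Field F] [AddCommGroup V] [Module F V]
    {B : LinearMap.BilinForm F V} (hA : B.IsAlt) {e f : V} (h : B e f ≠ 0) :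
    Disjoint (Submodule.span F {e, f}) (B.orthogonal (Submodule.span F {e, f})) := by
  rw [Submodule.disjoint_def]
  intro x hx hx'
  obtain ⟨a, b, rfl⟩ := Submodule.mem_span_pair.1 hx
  have h1 := hx' e (Submodule.subset_span (by simp))
  have h2 := hx' f (Submodule.subset_span (by simp))
  have h' : B f e ≠ 0 := fun hfe => h (hA.isRefl _ _ hfe)
  simp only [map_add, map_smul, hA.self_eq_zero, smul_eq_mul, mul_zero,
    zero_add, add_zero, mul_eq_zero, h, h', or_false] at h1 h2
  simp [h1, h2]

theorem finrank_span_pair {F V : Type*} [Field F] [AddCommGroup V] [Module F V]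
    {B : LinearMap.BilinForm F V} (hA : B.IsAlt) {e f : V} (h : B e f ≠ 0) :
    finrank F (Submodule.span F {e, f}) = 2 := by
  have hli : LinearIndependent F ![e, f] := by
    rw [LinearIndependent.pair_iff]
    intro a b hab
    have h1 : B e (a • e + b • f) = 0 := by rw [hab, map_zero]
    have h2 : B (a • e + b • f) f = 0 := by rw [hab, map_zero, LinearMap.zero_apply]
    simp only [map_add, map_smul, hA.self_eq_zero, smul_eq_mul, mul_zero, zero_add, add_zero,
      mul_eq_zero, h, or_false, LinearMap.add_apply, LinearMap.smul_apply] at h1 h2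
    exact ⟨h2, h1⟩
  rw [← Matrix.range_cons_cons_empty, finrank_span_eq_card hli, Fintype.card_fin]

/-- The sum of two orthogonal nondegenerate subspaces is nondegenerate. -/
theorem disjoint_sup_orthogonal {F V : Type*} [Field F] [AddCommGroup V] [Module F V]
    {B : LinearMap.BilinForm F V} (hB : B.IsRefl) {H P : Submodule F V} (hHP : P ≤ B.orthogonal H)
    (hH : Disjoint H (B.orthogonal H)) (hP : Disjoint P (B.orthogonal P)) :
    Disjoint (H ⊔ P) (B.orthogonal (H ⊔ P)) := by
  rw [Submodule.disjoint_def] at *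
  intro x hx hx'
  obtain ⟨a, ha, b, hb, rfl⟩ := Submodule.mem_sup.1 hx
  have h1 : a = 0 := by
    refine hH a ha fun n hn => ?_
    have := hx' n (Submodule.mem_sup_left hn)
    rwa [map_add, hHP hb n hn, add_zero] at this
  have h2 : b = 0 := by
    refine hP b hb fun n hn => ?_
    have := hx' n (Submodule.mem_sup_right hn)
    rwa [map_add, hB _ _ (hHP hn a ha), zero_add] at this
  simp [h1, h2]

/-- In a symplectic space of dimension `2 n`, the orthogonal of a subspace of dimension at most
`n - r` contains a nondegenerate subspace of dimension `2 r`. -/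
theorem exists_nondegenerate_le_orthogonal {F V : Type*} [Field F] [AddCommGroup V] [Module F V]
    [FiniteDimensional F V] {B : LinearMap.BilinForm F V} (hB : B.Nondegenerate) (hA : B.IsAlt)
    {n : ℕ} (hn : finrank F V = 2 * n) (E : Submodule F V) (r : ℕ) (hr : finrank F E + r ≤ n) :
    ∃ H ≤ B.orthogonal E, Disjoint H (B.orthogonal H) ∧ finrank F H = 2 * r := by
  induction r with
  | zero => exact ⟨⊥, bot_le, disjoint_bot_left, by simp⟩
  | succ r ih =>
    obtain ⟨H, hHE, hH, hHr⟩ := ih (by omega)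
    obtain ⟨e, he, f, hf, hef⟩ :
        ∃ e ∈ B.orthogonal (H ⊔ E), ∃ f ∈ B.orthogonal (H ⊔ E), B e f ≠ 0 := by
      by_contra! hcon
      have hle : B.orthogonal (H ⊔ E) ≤ E := by
        intro z hz
        have hz' : z ∈ B.orthogonal (B.orthogonal (H ⊔ E)) := fun y hy => hcon y hy z hz
        rw [orthogonal_orthogonal hB hA.isRefl] at hz'
        obtain ⟨h, hh, e, he, rfl⟩ := Submodule.mem_sup.1 hz'
        have h0 : h = 0 := by
          refine Submodule.disjoint_def.1 hH h hh fun y hy => ?_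
          have := hz y (Submodule.mem_sup_left hy)
          rwa [map_add, hA.isRefl _ _ (hHE hy e he), add_zero] at this
        simpa [h0] using he
      have h1 := Submodule.finrank_mono hle
      rw [finrank_orthogonal hB] at h1
      have h2 := Submodule.finrank_add_le_finrank_add_finrank H E
      omega
    have hP : Submodule.span F {e, f} ≤ B.orthogonal (H ⊔ E) := by
      rw [Submodule.span_le]
      rintro x (rfl | rfl) <;> assumption
    have hPH := hP.trans (orthogonal_le (B := B) (le_sup_left : H ≤ H ⊔ E))
    refine ⟨H ⊔ Submodule.span F {e, f},
      sup_le hHE (hP.trans (orthogonal_le le_sup_right)),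
      disjoint_sup_orthogonal hA.isRefl hPH hH (disjoint_span_pair_orthogonal hA hef), ?_⟩
    have h1 := Submodule.finrank_sup_add_finrank_inf_eq H (Submodule.span F {e, f})
    rw [(hH.mono_right hPH).eq_bot, finrank_bot, finrank_span_pair hA hef] at h1
    omega

/-- A totally isotropic subspace `D` of a symplectic space of dimension `2 n` is the radical of
a subspace of dimension `dim D + 2 r` inside `Dᗮ` avoiding a given vector outside `D`, whenever
`dim D + r < n`. -/
theorem exists_radical_eq {F V : Type*} [Field F] [AddCommGroup V] [Module F V]
    [FiniteDimensional F V] {B : LinearMap.BilinForm F V} (hB : B.Nondegenerate) (hA : B.IsAlt)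
    {n : ℕ} (hn : finrank F V = 2 * n) {D : Submodule F V} (hD : D ≤ B.orthogonal D)
    {u : V} (hu : u ∉ D) (r : ℕ) (hr : finrank F D + r < n) :
    ∃ C ≤ B.orthogonal D, C ⊓ B.orthogonal C = D ∧ finrank F C = finrank F D + 2 * r ∧ u ∉ C := by
  obtain ⟨H, hHE, hH, hHr⟩ := exists_nondegenerate_le_orthogonal hB hA hn
    (D ⊔ Submodule.span F {u}) r (by
      have h1 := Submodule.finrank_add_le_finrank_add_finrank D (Submodule.span F {u})
      have h2 := finrank_span_singleton (K := F) (v := u) fun h => hu (h ▸ D.zero_mem)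
      omega)
  have hHD : H ≤ B.orthogonal D := hHE.trans (orthogonal_le le_sup_left)
  have hDH : D ≤ B.orthogonal H := fun d hd h hh => hA.isRefl _ _ (hHD hh d hd)
  have huH : u ∈ B.orthogonal H := fun h hh => hA.isRefl _ _
    (hHE hh u (Submodule.mem_sup_right (Submodule.mem_span_singleton_self u)))
  have key : ∀ x ∈ D ⊔ H, x ∈ B.orthogonal H → x ∈ D := by
    intro x hx hx'
    obtain ⟨d, hd, h, hh, rfl⟩ := Submodule.mem_sup.1 hx
    have h0 : h = 0 := Submodule.disjoint_def.1 hH h hh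
      (by simpa using (B.orthogonal H).sub_mem hx' (hDH hd))
    simpa [h0] using hd
  refine ⟨D ⊔ H, sup_le hD hHD, le_antisymm ?_ ?_, ?_, fun h => hu (key u h huH)⟩
  · rintro x ⟨hx, hx'⟩
    exact key x hx (orthogonal_le le_sup_right hx')
  · refine le_inf le_sup_left fun d hd x hx => ?_
    obtain ⟨d', hd', h, hh, rfl⟩ := Submodule.mem_sup.1 hx
    rw [map_add, LinearMap.add_apply, hD hd d' hd', hDH hd h hh, add_zero]
  · have h1 := Submodule.finrank_sup_add_finrank_inf_eq D H
    rw [(hH.symm.mono_left hDH).eq_bot, finrank_bot] at h1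
    omega

end LinearMap.BilinForm

/-- The symplectic form `⟨(a|b)|(a'|b')⟩ = a'·b − a·b'` on `F^{2n}`. -/
def sympForm (F : Type*) [Field F] (n : ℕ) :
    LinearMap.BilinForm F ((Fin n → F) × (Fin n → F)) :=
  LinearMap.mk₂ F (fun u w => ∑ i, (w.1 i * u.2 i - u.1 i * w.2 i))
    (fun u v w => by
      rw [← Finset.sum_add_distrib]; exact Finset.sum_congr rfl fun i _ => by simp; ring)
    (fun c u w => by
      rw [smul_eq_mul, Finset.mul_sum]; exact Finset.sum_congr rfl fun i _ => by simp; ring)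
    (fun u v w => by
      rw [← Finset.sum_add_distrib]; exact Finset.sum_congr rfl fun i _ => by simp; ring)
    (fun c u w => by
      rw [smul_eq_mul, Finset.mul_sum]; exact Finset.sum_congr rfl fun i _ => by simp; ring)

theorem sympForm_apply {F : Type*} [Field F] {n : ℕ} (u w : (Fin n → F) × (Fin n → F)) :
    sympForm F n u w = ∑ i, (w.1 i * u.2 i - u.1 i * w.2 i) := rfl

theorem sympForm_isAlt (F : Type*) [Field F] (n : ℕ) : (sympForm F n).IsAlt := fun u => by
  rw [sympForm_apply]
  exact Finset.sum_eq_zero fun i _ => by ring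

theorem sympForm_nondegenerate (F : Type*) [Field F] (n : ℕ) : (sympForm F n).Nondegenerate := by
  have hl : (sympForm F n).SeparatingLeft := by
    intro u hu
    ext i
    · have := hu (0, Pi.single i 1)
      simpa [sympForm_apply, Pi.single_apply] using this
    · have := hu (Pi.single i 1, 0)
      simpa [sympForm_apply, Pi.single_apply] using this
  exact ⟨hl, fun u hu => hl u fun w => (sympForm_isAlt F n).isRefl _ _ (hu w)⟩

theorem eq_zero_of_forall_trace_mul_eq_zero {p : ℕ} [Fact p.Prime] {F : Type*} [Field F] [Finite F]
    [Algebra (ZMod p) F] {x : F} (h : ∀ c : F, Algebra.trace (ZMod p) F (c * x) = 0) : x = 0 := by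
  have : Module.Finite (ZMod p) F := Module.Finite.of_finite
  refine (traceForm_nondegenerate (ZMod p) F).1 x fun c => ?_
  rw [Algebra.traceForm_apply, mul_comm]
  exact h c

/-- The trace-symplectic dual of an `F`-linear code is its symplectic dual. -/
theorem sdual_coe {p : ℕ} [Fact p.Prime] {F : Type*} [Field F] [Finite F] [Algebra (ZMod p) F]
    {n : ℕ} (C : Submodule F ((Fin n → F) × (Fin n → F))) :
    sdual p (C : Set ((Fin n → F) × (Fin n → F))) = (sympForm F n).orthogonal C := by
  have htr (v w : (Fin n → F) × (Fin n → F)) :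
      traceSymp p v w = Algebra.trace (ZMod p) F (sympForm F n v w) := rfl
  ext v
  constructor
  · intro hv w hw
    refine (sympForm_isAlt F n).isRefl _ _ (eq_zero_of_forall_trace_mul_eq_zero (p := p) fun c => ?_)
    have := hv (c • w) (C.smul_mem c hw)
    rwa [htr, map_smul, smul_eq_mul] at this
  · intro hv w hw
    rw [htr, (sympForm_isAlt F n).isRefl _ _ (hv w hw), map_zero]

theorem le_minSwt {F : Type*} [Field F] {n d : ℕ} {X : Set ((Fin n → F) × (Fin n → F))}
    (hX : ∃ v ∈ X, v ≠ 0) (h : ∀ v ∈ X, v ≠ 0 → d ≤ swt v) : d ≤ minSwt X := by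
  obtain ⟨v, hv, hv0⟩ := hX
  refine le_csInf ⟨swt v, v, ⟨hv, hv0⟩, rfl⟩ ?_
  rintro _ ⟨w, ⟨hw, hw0⟩, rfl⟩
  exact h w hw hw0

theorem minSwt_le {F : Type*} [Field F] {n : ℕ} {X : Set ((Fin n → F) × (Fin n → F))}
    {v : (Fin n → F) × (Fin n → F)} (hv : v ∈ X) (hv0 : v ≠ 0) : minSwt X ≤ swt v :=
  Nat.sInf_le ⟨v, ⟨hv, hv0⟩, rfl⟩

/-- A nonzero self-orthogonal `F`-linear code `D` of dimension `s` whose dual has minimum weight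
`d`, attained outside `D`, yields pure subsystem codes `[[n, n - s - r, r, d]]`. -/
theorem exists_pure_subsystem_code {p : ℕ} [Fact p.Prime] {F : Type*} [Field F] [Fintype F]
    [Algebra (ZMod p) F] {n d k r : ℕ} {D : Submodule F ((Fin n → F) × (Fin n → F))}
    (hD : D ≤ (sympForm F n).orthogonal D) (hD0 : 0 < finrank F D)
    (hd : ∀ v ∈ (sympForm F n).orthogonal D, v ≠ 0 → d ≤ swt v)
    {u : (Fin n → F) × (Fin n → F)} (huD : u ∈ (sympForm F n).orthogonal D) (hu : u ∉ D)
    (hud : swt u = d) (hk : 0 < k) (hn : k + r + finrank F D = n) :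
    ∃ C : Submodule F ((Fin n → F) × (Fin n → F)), IsLinSubsysCode p k r d C ∧
      d ≤ minSwt (C : Set ((Fin n → F) × (Fin n → F))) := by
  obtain ⟨C, hCD, hrad, hC, huC⟩ := LinearMap.BilinForm.exists_radical_eq
    (sympForm_nondegenerate F n) (sympForm_isAlt F n) (n := n) (by simp; ring) hD hu r
    (by omega)
  have hradS : (C : Set ((Fin n → F) × (Fin n → F))) ∩ sdual p C = D := by
    rw [sdual_coe, ← hrad, Submodule.coe_inf]
  have hu0 : u ≠ 0 := fun h => hu (h ▸ D.zero_mem)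
  have hcard (W : Submodule F ((Fin n → F) × (Fin n → F))) :
      Nat.card W = Fintype.card F ^ finrank F W := by
    rw [Module.natCard_eq_pow_finrank (K := F), Nat.card_eq_fintype_card]
  refine ⟨C, ⟨?_, ?_, ?_, ?_⟩, le_minSwt ?_ fun v hv => hd v (hCD hv)⟩
  · change _ * Nat.card C = _
    rw [hcard, hC, ← pow_add, ← pow_add]
    congr 1
    omega
  · simp only [Submodule.coe_toAddSubgroup, hradS]
    change _ * _ * Nat.card D = _
    rw [hcard, ← pow_add, ← pow_add, hn]
  · simp only [Submodule.coe_toAddSubgroup, hradS]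
    rw [sdual_coe]
    intro h
    exact absurd (SetLike.coe_injective h ▸ huD) huC
  · simp only [Submodule.coe_toAddSubgroup, hradS]
    rw [sdual_coe]
    exact fun _ => le_antisymm (le_minSwt ⟨u, ⟨huD, huC⟩, hu0⟩ fun v hv => hd v hv.1)
      (hud ▸ minSwt_le ⟨huD, huC⟩ hu0)
  · have : 0 < finrank F C := by omega
    have := finrank_pos_iff_exists_ne_zero.1 this
    obtain ⟨⟨x, hx⟩, hx0⟩ := this
    exact ⟨x, hx, fun h => hx0 (Subtype.ext h)⟩

section ReedSolomon

variable {F K : Type*} [Field F] [Fintype F] [Field K] [Algebra F K]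

theorem exists_pow_card_ne [Fintype K] (hK : Fintype.card K = Fintype.card F ^ 2) :
    ∃ β : K, β ^ Fintype.card F ≠ β := by
  by_contra! h
  have h1 : FiniteField.frobeniusAlgHom F K = 1 := AlgHom.ext h
  have h2 := FiniteField.orderOf_frobeniusAlgHom F K
  have h3 := Module.card_eq_pow_finrank (K := F) (V := K)
  rw [hK] at h3
  have h4 := Nat.pow_right_injective Fintype.one_lt_card h3
  rw [h1, orderOf_one, ← h4] at h2
  omega

theorem finrank_eq_two [Fintype K] (hK : Fintype.card K = Fintype.card F ^ 2) :
    finrank F K = 2 := by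
  have h := Module.card_eq_pow_finrank (K := F) (V := K)
  rw [hK] at h
  exact (Nat.pow_right_injective Fintype.one_lt_card h).symm

theorem add_pow_card_base (x y : K) :
    (x + y) ^ Fintype.card F = x ^ Fintype.card F + y ^ Fintype.card F :=
  map_add (FiniteField.frobeniusAlgHom F K) x y

theorem sum_pow_card_base {ι : Type*} (s : Finset ι) (f : ι → K) :
    (∑ i ∈ s, f i) ^ Fintype.card F = ∑ i ∈ s, f i ^ Fintype.card F :=
  map_sum (FiniteField.frobeniusAlgHom F K) f s

theorem algebraMap_pow_card_base (a : F) :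
    algebraMap F K a ^ Fintype.card F = algebraMap F K a :=
  (FiniteField.frobeniusAlgHom F K).commutes a

theorem pow_pow_of_card_eq_sq {K : Type*} [Field K] [Fintype K] {q : ℕ}
    (hK : Fintype.card K = q ^ 2) (x : K) : (x ^ q) ^ q = x := by
  rw [← pow_mul, ← sq, ← hK, FiniteField.pow_card]

/-- Identification of `F^{2n}` with `K^n` for the quadratic extension `K` of `F`, which turns the
symplectic form into a multiple of the skew-symmetrized Hermitian form. -/
theorem exists_linearEquiv_quadratic [Fintype K] (hK : Fintype.card K = Fintype.card F ^ 2) (n : ℕ) :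
    ∃ (Φ : ((Fin n → F) × (Fin n → F)) ≃ₗ[F] (Fin n → K)) (c : K), c ≠ 0 ∧
      (∀ v i, Φ v i = 0 ↔ v.1 i = 0 ∧ v.2 i = 0) ∧
      ∀ u w, algebraMap F K (sympForm F n u w) * c =
        ∑ i, (Φ w i * Φ u i ^ Fintype.card F - Φ w i ^ Fintype.card F * Φ u i) := by
  obtain ⟨β, hβ⟩ := exists_pow_card_ne hK
  let φ : ((Fin n → F) × (Fin n → F)) →ₗ[F] (Fin n → K) :=
    { toFun := fun v i => algebraMap F K (v.1 i) + algebraMap F K (v.2 i) * β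
      map_add' := fun u v => by ext i; simp; ring
      map_smul' := fun a v => by ext i; simp [Algebra.smul_def]; ring }
  have hφ (v i) : φ v i = algebraMap F K (v.1 i) + algebraMap F K (v.2 i) * β := rfl
  have hzero (v i) : φ v i = 0 ↔ v.1 i = 0 ∧ v.2 i = 0 := by
    refine ⟨fun h => ?_, fun h => by simp [hφ, h]⟩
    rw [hφ] at h
    have hq : algebraMap F K (v.1 i) + algebraMap F K (v.2 i) * β ^ Fintype.card F = 0 := by
      have := congrArg (· ^ Fintype.card F) h
      simpa [add_pow_card_base, mul_pow, algebraMap_pow_card_base] using this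
    have h2 : algebraMap F K (v.2 i) * (β ^ Fintype.card F - β) = 0 := by
      linear_combination hq - h
    have h3 : algebraMap F K (v.2 i) = 0 :=
      (mul_eq_zero.1 h2).resolve_right (sub_ne_zero.2 hβ)
    rw [h3, zero_mul, add_zero] at h
    simpa using And.intro h h3
  have hinj : Function.Injective φ := by
    rw [injective_iff_map_eq_zero]
    intro v hv
    ext i
    · exact ((hzero v i).1 (congrFun hv i)).1
    · exact ((hzero v i).1 (congrFun hv i)).2
  have : FiniteDimensional F K := Module.Finite.of_finite
  have hfin : finrank F ((Fin n → F) × (Fin n → F)) = finrank F (Fin n → K) := by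
    rw [Module.finrank_pi_fintype]
    simp [finrank_eq_two hK]
    ring
  refine ⟨LinearEquiv.ofBijective φ
    ⟨hinj, (LinearMap.injective_iff_surjective_of_finrank_eq_finrank hfin).1 hinj⟩,
    β ^ Fintype.card F - β, sub_ne_zero.2 hβ, hzero, fun u w => ?_⟩
  change _ = ∑ i, (φ w i * φ u i ^ Fintype.card F - φ w i ^ Fintype.card F * φ u i)
  simp only [hφ, sympForm_apply, map_sum, Finset.sum_mul,
    add_pow_card_base, mul_pow, algebraMap_pow_card_base, map_sub, map_mul]
  exact Finset.sum_congr rfl fun i _ => by ring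

/-- The power sums of degree less than `|K| - 1` over a finite field `K` vanish. -/
theorem sum_eval_eq_zero_of_natDegree_lt {K : Type*} [Field K] [Fintype K] {f : K[X]}
    (hf : f.natDegree < Fintype.card K - 1) :
    ∑ x, f.eval x = 0 := by
  simp_rw [eval_eq_sum_range]
  rw [Finset.sum_comm]
  refine Finset.sum_eq_zero fun i hi => ?_
  rw [← Finset.mul_sum, FiniteField.sum_pow_lt_card_sub_one, mul_zero]
  have := Finset.mem_range.1 hi
  omega

/-- Extended Reed–Solomon codes of dimension less than `q` over `F_{q²}` are Hermitian
self-orthogonal. -/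
theorem sum_eval_mul_eval_pow_eq_zero {K : Type*} [Field K] [Fintype K] {q : ℕ}
    (hK : Fintype.card K = q ^ 2) {d : ℕ} (hd : d < q) {f g : K[X]} (hf : f.degree < d)
    (hg : g.degree < d) : ∑ x, f.eval x * g.eval x ^ q = 0 := by
  rcases eq_or_ne f 0 with rfl | hf0
  · simp
  rcases eq_or_ne g 0 with rfl | hg0
  · refine Finset.sum_eq_zero fun x _ => ?_
    rw [eval_zero, zero_pow (by omega), mul_zero]
  rw [← natDegree_lt_iff_degree_lt hf0] at hf
  rw [← natDegree_lt_iff_degree_lt hg0] at hg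
  simp_rw [← eval_pow, ← eval_mul]
  refine sum_eval_eq_zero_of_natDegree_lt (natDegree_mul_le.trans_lt ?_)
  rw [natDegree_pow, hK]
  obtain ⟨m, rfl⟩ : ∃ m, q = m + 2 := ⟨q - 2, by omega⟩
  have h1 : (m + 2) * g.natDegree ≤ (m + 2) * m := Nat.mul_le_mul_left _ (by omega)
  have h2 : (m + 2) ^ 2 = (m + 2) * m + 2 * m + 4 := by ring
  omega

/-- The Reed–Solomon code of evaluations at the points `e i` of the polynomials of degree less
than `d`. -/
noncomputable def rsCode {K : Type*} [Field K] {n : ℕ} (e : Fin n → K) (d : ℕ) :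
    Submodule K (Fin n → K) :=
  (degreeLT K d).map (LinearMap.pi fun i => leval (e i))

theorem mem_rsCode {K : Type*} [Field K] {n : ℕ} {e : Fin n → K} {d : ℕ} {x : Fin n → K} :
    x ∈ rsCode e d ↔ ∃ f : K[X], f.degree < d ∧ ∀ i, f.eval (e i) = x i := by
  simp [rsCode, mem_degreeLT, funext_iff]

theorem finrank_rsCode {K : Type*} [Field K] {n : ℕ} {e : Fin n → K}
    (he : Function.Injective e) {d : ℕ} (hd : d ≤ n) :
    finrank K (rsCode e d) = d := by
  rw [rsCode, ← LinearMap.range_domRestrict, LinearMap.finrank_range_of_inj,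
    (degreeLTEquiv K d).finrank_eq, finrank_fin_fun]
  rw [injective_iff_map_eq_zero]
  rintro ⟨f, hf⟩ h
  rw [mem_degreeLT] at hf
  refine Subtype.ext (eq_zero_of_degree_lt_of_eval_index_eq_zero (s := Finset.univ) he.injOn
    (hf.trans_le ?_) fun i _ => congrFun h i)
  simpa using hd

/-- A vector annihilated by the skew-symmetrized Hermitian products with a Reed–Solomon code of
dimension `d` is zero or has more than `d` nonzero coordinates. -/
theorem lt_card_support_of_orthogonal_rsCode [Fintype K] (hK : Fintype.card K = Fintype.card F ^ 2)
    {n d : ℕ} {e : Fin n → K} (he : Function.Injective e) {x : Fin n → K} (hx : x ≠ 0)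
    (h : ∀ y ∈ rsCode e d, ∑ i, (x i * y i ^ Fintype.card F - x i ^ Fintype.card F * y i) = 0) :
    d < Nat.card {i // x i ≠ 0} := by
  classical
  rw [Nat.card_eq_fintype_card, Fintype.card_subtype]
  set T : Finset (Fin n) := {i | x i ≠ 0} with hT
  by_contra! hTd
  obtain ⟨j, hj⟩ := Function.ne_iff.1 hx
  have hjT : j ∈ T := by simpa [hT] using hj
  have key (c : K) : x j * c ^ Fintype.card F = x j ^ Fintype.card F * c := by
    have hy : (fun i => (c • Lagrange.basis T e j).eval (e i)) ∈ rsCode e d := by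
      refine mem_rsCode.2 ⟨_, lt_of_lt_of_le ?_ (Nat.cast_le.2 hTd), fun i => rfl⟩
      refine (degree_smul_le _ _).trans_lt ?_
      rw [Lagrange.degree_basis he.injOn hjT]
      exact_mod_cast Nat.sub_lt (Finset.card_pos.2 ⟨j, hjT⟩) one_pos
    have := h _ hy
    rw [Finset.sum_eq_single_of_mem j (Finset.mem_univ j)] at this
    · simpa [Lagrange.eval_basis_self he.injOn hjT, sub_eq_zero] using this
    · intro i _ hij
      by_cases hi : i ∈ T
      · simp [Lagrange.eval_basis_of_ne hij.symm hi]
      · have : x i = 0 := by simpa [hT] using hi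
        simp [this]
  have h1 : x j = x j ^ Fintype.card F := by simpa using key 1
  obtain ⟨β, hβ⟩ := exists_pow_card_ne hK
  have h2 := key β
  rw [← h1] at h2
  exact hβ (mul_left_cancel₀ hj h2)

/-- The Hermitian dual of a Reed–Solomon code of dimension `d` contains a vector with exactly
`d + 1` nonzero coordinates. -/
theorem exists_card_support_eq_orthogonal_rsCode [Fintype K] (hK : Fintype.card K = Fintype.card F ^ 2)
    {n d : ℕ} {e : Fin n → K} (he : Function.Injective e) (hd : d < n) :
    ∃ x : Fin n → K, Nat.card {i // x i ≠ 0} = d + 1 ∧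
      ∀ y ∈ rsCode e d, ∑ i, (x i * y i ^ Fintype.card F - x i ^ Fintype.card F * y i) = 0 := by
  classical
  obtain ⟨T, -, hT⟩ := Finset.exists_subset_card_eq
    (s := (Finset.univ : Finset (Fin n))) (n := d + 1) (by simpa using hd)
  set w : Fin n → K := fun i => if i ∈ T then (∏ j ∈ T.erase i, (e i - e j))⁻¹ else 0 with hw
  refine ⟨fun i => w i ^ Fintype.card F, ?_, fun y hy => ?_⟩
  · rw [Nat.card_eq_fintype_card, Fintype.card_subtype, ← hT]
    congr 1
    ext i
    by_cases hi : i ∈ T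
    · have : ∏ j ∈ T.erase i, (e i - e j) ≠ 0 := Finset.prod_ne_zero_iff.2 fun j hj =>
        sub_ne_zero.2 (he.ne (Finset.ne_of_mem_erase hj).symm)
      simpa [hw, hi] using fun h => absurd h this
    · simp [hw, hi]
  · obtain ⟨f, hf, hfy⟩ := mem_rsCode.1 hy
    have h0 : ∑ i, w i * y i = 0 := by
      have h1 := Lagrange.coeff_eq_sum (s := T) (v := e) he.injOn (P := f)
        (hf.trans (by rw [hT]; exact_mod_cast Nat.lt_succ_self d))
      rw [hT, Nat.add_sub_cancel, coeff_eq_zero_of_degree_lt hf] at h1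
      rw [h1, ← Finset.sum_subset (Finset.subset_univ T) fun i _ hi => by simp [hw, hi]]
      exact Finset.sum_congr rfl fun i hi => by simp [hw, hi, hfy, div_eq_inv_mul]
    simp_rw [pow_pow_of_card_eq_sq hK, ← mul_pow, Finset.sum_sub_distrib, ← sum_pow_card_base,
      h0]
    simp

/-- Nonzero words of a Reed–Solomon code of dimension `d` have more than `n - d` nonzero
coordinates. -/
theorem lt_card_support_of_mem_rsCode {K : Type*} [Field K] {n d : ℕ} {e : Fin n → K}
    (he : Function.Injective e)
    {x : Fin n → K} (hx : x ≠ 0) (hxd : x ∈ rsCode e d) : n < Nat.card {i // x i ≠ 0} + d := by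
  classical
  obtain ⟨f, hf, hfx⟩ := mem_rsCode.1 hxd
  rw [Nat.card_eq_fintype_card, Fintype.card_subtype]
  by_contra! hcon
  have hadd := Finset.card_filter_add_card_filter_not (s := Finset.univ) (fun i => x i ≠ 0)
  rw [Finset.card_univ, Fintype.card_fin] at hadd
  have hf0 : f = 0 := by
    refine eq_zero_of_degree_lt_of_eval_index_eq_zero (s := {i | ¬ x i ≠ 0}) he.injOn
      (hf.trans_le (Nat.cast_le.2 (by omega))) fun i hi => ?_
    simpa [hfx] using hi
  exact hx (funext fun i => by rw [← hfx, hf0, eval_zero, Pi.zero_apply])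

/-- The self-orthogonal code obtained from an extended Reed–Solomon code over the quadratic
extension: it has dimension `2 d`, and its dual has minimum weight `d + 1`, attained by a vector
outside the code. -/
theorem exists_selfOrthogonal_code [Fintype K] (hK : Fintype.card K = Fintype.card F ^ 2) {d : ℕ}
    (hd : d < Fintype.card F) (hd2 : 2 * d < Fintype.card F ^ 2) :
    ∃ D : Submodule F ((Fin (Fintype.card F ^ 2) → F) × (Fin (Fintype.card F ^ 2) → F)),
      D ≤ (sympForm F _).orthogonal D ∧ finrank F D = 2 * d ∧
      (∀ v ∈ (sympForm F _).orthogonal D, v ≠ 0 → d + 1 ≤ swt v) ∧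
      ∃ u ∈ (sympForm F _).orthogonal D, u ∉ D ∧ swt u = d + 1 := by
  have e : Fin (Fintype.card F ^ 2) ≃ K := (Fintype.equivFinOfCardEq hK).symm
  obtain ⟨Φ, c, hc, hzero, hform⟩ := exists_linearEquiv_quadratic hK (Fintype.card F ^ 2)
  set D := ((rsCode e d).restrictScalars F).map Φ.symm.toLinearMap with hD
  have hmem (v) : v ∈ D ↔ Φ v ∈ rsCode e d := by
    rw [hD, Submodule.mem_map_equiv]
    rfl
  have hswt (v) : swt v = Nat.card {i // Φ v i ≠ 0} :=
    Nat.card_congr (Equiv.subtypeEquivRight fun i => not_congr (hzero v i).symm)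
  have hB (u w) : sympForm F _ u w = 0 ↔
      ∑ i, (Φ w i * Φ u i ^ Fintype.card F - Φ w i ^ Fintype.card F * Φ u i) = 0 := by
    rw [← hform, mul_eq_zero, or_iff_left hc, map_eq_zero (algebraMap F K)]
  have horth (v) : v ∈ (sympForm F _).orthogonal D ↔ ∀ y ∈ rsCode e d,
      ∑ i, (Φ v i * y i ^ Fintype.card F - Φ v i ^ Fintype.card F * y i) = 0 := by
    rw [LinearMap.BilinForm.mem_orthogonal_iff, Φ.symm.forall_congr_left]
    simp [hmem, hB]
  have hdn : d < Fintype.card F ^ 2 := by omega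
  refine ⟨D, fun v hv => (horth v).2 fun y hy => ?_, ?_, fun v hv hv0 => ?_, ?_⟩
  · obtain ⟨f, hf, hfv⟩ := mem_rsCode.1 ((hmem v).1 hv)
    obtain ⟨g, hg, hgy⟩ := mem_rsCode.1 hy
    have h1 := sum_eval_mul_eval_pow_eq_zero hK hd hf hg
    have h2 := sum_eval_mul_eval_pow_eq_zero hK hd hg hf
    rw [← e.sum_comp] at h1 h2
    simp only [hfv, hgy] at h1 h2
    rw [Finset.sum_sub_distrib, h1, zero_sub, neg_eq_zero, ← h2]
    exact Finset.sum_congr rfl fun i _ => mul_comm _ _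
  · rw [hD, LinearEquiv.finrank_map_eq]
    change finrank F (rsCode e d) = _
    rw [← Module.finrank_mul_finrank F K, finrank_rsCode e.injective hdn.le, finrank_eq_two hK]
  · rw [hswt]
    exact lt_card_support_of_orthogonal_rsCode hK e.injective (by simpa using hv0) ((horth v).1 hv)
  · obtain ⟨x, hx, hxy⟩ := exists_card_support_eq_orthogonal_rsCode hK e.injective hdn
    refine ⟨Φ.symm x, (horth _).2 (by simpa using hxy), fun h => ?_, by simpa [hswt] using hx⟩
    have hx0 : x ≠ 0 := by
      rintro rfl
      simp at hx
    have := lt_card_support_of_mem_rsCode e.injective hx0 (by simpa using (hmem _).1 h)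
    omega

end ReedSolomon

/-- For all `0 ≤ δ < q - 1` and `0 ≤ r' < q² - 2δ - 2`, there exists a pure
`F_q`-linear `[[q², q² - 2δ - 2 - r', r', δ+2]]_q` MDS subsystem code. -/
theorem stmt_11 (p m : ℕ) [Fact p.Prime] (hm : 0 < m)
    (F : Type) [Field F] [Fintype F] [Algebra (ZMod p) F]
    (hq : Fintype.card F = p ^ m) :
    ∀ δ r' : ℕ, δ + 1 < Fintype.card F → r' + 2 * δ + 2 < Fintype.card F ^ 2 →
      ∃ k, k + r' + 2 * δ + 2 = Fintype.card F ^ 2 ∧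
        ∃ C : Submodule F ((Fin (Fintype.card F ^ 2) → F) × (Fin (Fintype.card F ^ 2) → F)),
          IsLinSubsysCode p k r' (δ + 2) C ∧
          δ + 2 ≤ minSwt (C : Set ((Fin (Fintype.card F ^ 2) → F) ×
            (Fin (Fintype.card F ^ 2) → F))) := by
  intro δ r' hδ hr'
  have := charP_of_injective_algebraMap (algebraMap (ZMod p) F).injective p
  have : Fintype (FiniteField.Extension F p 2) := Fintype.ofFinite _
  have hK : Fintype.card (FiniteField.Extension F p 2) = Fintype.card F ^ 2 := by
    simpa only [Nat.card_eq_fintype_card] using FiniteField.natCard_extension F p 2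
  obtain ⟨D, hD, hfin, hd, u, huD, hu, hud⟩ :=
    exists_selfOrthogonal_code hK hδ (by omega)
  exact ⟨Fintype.card F ^ 2 - (r' + 2 * δ + 2), by omega,
    exists_pure_subsystem_code hD (by omega) hd huD hu hud (by omega) (by omega)⟩
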